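/- Let σ > 0, ε₀ > 0 and δ ∈ ℝ. There exists a constant C = C(ε₀, δ, σ) > 0 such that for every s ≤ 0 and all Schwartz functions u, v : ℝ → ℂ whose Fourier transforms are supported in [ε₀, ∞), the gauge transform 𝒢(w) := w · exp(−δ·∂ₓ⁻¹(w w*)) satisfies ‖𝒢(u) − 𝒢(v)‖_{E^s_σ} ≤ ( exp(C ‖u‖²_{E^s_σ}) + exp(C ‖v‖²_{E^s_σ}) ) ‖u − v‖_{E^s_σ}. -/

import Mathlib

open MeasureTheory Real FourierTransform

/-- The `E^s_σ` norm of `f : ℝ → ℂ`: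
`‖f‖_{E^s_σ} = (∫ ⟨ξ⟩^{2σ} 2^{2s|ξ|} |𝓕f(ξ)|² dξ)^{1/2}`, with `⟨ξ⟩^{2σ} = (1+ξ²)^σ`. -/
noncomputable def Enorm (s σ : ℝ) (f : ℝ → ℂ) : ℝ :=
  (∫ ξ : ℝ, (1 + ξ ^ 2) ^ σ * (2 : ℝ) ^ (2 * s * |ξ|) * ‖𝓕 f ξ‖ ^ 2) ^ (1 / 2 : ℝ)

/-- The antiderivative `∂ₓ⁻¹ f (x) = ½(∫_{-∞}^x f − ∫_x^∞ f)`. -/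
noncomputable def pinv (f : ℝ → ℂ) (x : ℝ) : ℂ :=
  (1 / 2 : ℂ) * ((∫ y in Set.Iic x, f y) - ∫ y in Set.Ici x, f y)

/-- The gauge transform `𝒢(w) = w · exp(−δ ∂ₓ⁻¹(w w*))`, where `w*(x) = conj(w(−x))`. -/
noncomputable def gaugeT (δ : ℝ) (w : ℝ → ℂ) (x : ℝ) : ℂ :=
  w x * Complex.exp (-(δ : ℂ) * pinv (fun y => w y * (starRingEnd ℂ) (w (-y))) x)

open scoped ENNReal

theorem fourier_mul_fourierInv {f G : ℝ → ℂ} (hf : Integrable f) (hG : Integrable G) (ξ : ℝ) :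
    𝓕 (fun x => f x * 𝓕⁻ G x) ξ = ∫ η, G η * 𝓕 f (ξ - η) := by
  have hint : Integrable (fun p : ℝ × ℝ => 𝐞 (p.1 * p.2 - p.1 * ξ) • (f p.1 * G p.2))
      (volume.prod volume) := by
    refine (hf.mul_prod hG).mono ?_ (.of_forall fun p => by simp)
    have h : Continuous fun p : ℝ × ℝ => 𝐞 (p.1 * p.2 - p.1 * ξ) := by fun_prop
    exact h.aestronglyMeasurable.smul (hf.mul_prod hG).aestronglyMeasurable
  calc 𝓕 (fun x => f x * 𝓕⁻ G x) ξ
      = ∫ x, ∫ η, 𝐞 (x * η - x * ξ) • (f x * G η) := by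
        rw [Real.fourier_real_eq]
        congr 1 with x
        rw [Real.fourierInv_eq, ← integral_const_mul, Circle.smul_def, ← integral_smul]
        congr 1 with η
        rw [sub_eq_add_neg, AddChar.map_add_eq_mul]
        simp [Circle.smul_def]
        ring
    _ = ∫ η, ∫ x, 𝐞 (x * η - x * ξ) • (f x * G η) := integral_integral_swap hint
    _ = ∫ η, G η * 𝓕 f (ξ - η) := by
        congr 1 with η
        rw [Real.fourier_real_eq, ← integral_const_mul]
        congr 1 with x
        rw [show -(x * (ξ - η)) = x * η - x * ξ by ring]
        simp [Circle.smul_def]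
        ring

theorem continuous_fourierInv {G : ℝ → ℂ} (hG : Integrable G) : Continuous (𝓕⁻ G) := by
  rw [Real.fourierInv_eq_fourier_comp_neg]
  exact VectorFourier.fourierIntegral_continuous Real.continuous_fourierChar
    (by exact continuous_inner) hG.comp_neg

theorem continuous_fourier {f : ℝ → ℂ} (hf : Integrable f) : Continuous (𝓕 f) :=
  VectorFourier.fourierIntegral_continuous Real.continuous_fourierChar
    (by exact continuous_inner) hf

theorem norm_fourierInv_le (G : ℝ → ℂ) (x : ℝ) : ‖𝓕⁻ G x‖ ≤ ∫ η, ‖G η‖ := by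
  rw [Real.fourierInv_eq]
  refine (norm_integral_le_integral_norm _).trans_eq ?_
  simp

theorem Integrable.mul_fourierInv {f G : ℝ → ℂ} (hf : Integrable f) (hG : Integrable G) :
    Integrable (fun x => f x * 𝓕⁻ G x) := by
  exact hf.mul_bdd (c := ∫ η, ‖G η‖) (continuous_fourierInv hG).aestronglyMeasurable
    (.of_forall (norm_fourierInv_le G))

/-- The Cauchy–Schwarz inequality for `ℝ≥0∞`-valued functions. -/
theorem lintegral_mul_sq_le {α : Type*} [MeasurableSpace α] (μ : Measure α) {f g : α → ℝ≥0∞}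
    (hf : AEMeasurable f μ) (hg : AEMeasurable g μ) :
    (∫⁻ a, f a * g a ∂μ) ^ 2 ≤ (∫⁻ a, f a ^ 2 ∂μ) * ∫⁻ a, g a ^ 2 ∂μ := by
  have h := ENNReal.lintegral_mul_le_Lp_mul_Lq μ Real.HolderConjugate.two_two hf hg
  simp only [Pi.mul_apply, ENNReal.rpow_two] at h
  calc _ ≤ _ := pow_le_pow_left' h 2
    _ = _ := by
      rw [mul_pow, ← ENNReal.rpow_two, ← ENNReal.rpow_two, ← ENNReal.rpow_mul, ← ENNReal.rpow_mul]
      norm_num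

theorem eLpNorm_two_sq {α : Type*} [MeasurableSpace α] (μ : Measure α) (f : α → ℝ≥0∞) :
    eLpNorm f 2 μ ^ 2 = ∫⁻ a, f a ^ 2 ∂μ := by
  rw [eLpNorm_eq_lintegral_rpow_enorm_toReal (by norm_num) (by norm_num), ← ENNReal.rpow_two,
    ← ENNReal.rpow_mul]
  simp

/-- Young's inequality `L¹ * L² ⊆ L²` for `ℝ≥0∞`-valued functions. -/
theorem eLpNorm_two_lconvolution_le {F G : ℝ → ℝ≥0∞} (hF : Measurable F) (hG : AEMeasurable G) :
    eLpNorm (fun ξ => ∫⁻ η, G η * F (ξ - η)) 2 volume ≤ (∫⁻ η, G η) * eLpNorm F 2 volume := by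
  wlog hG' : Measurable G generalizing G
  · have h := this hG.measurable_mk.aemeasurable hG.measurable_mk
    rw [← lintegral_congr_ae hG.ae_eq_mk] at h
    refine le_trans (le_of_eq ?_) h
    congr 1 with ξ
    refine lintegral_congr_ae ?_
    filter_upwards [hG.ae_eq_mk] with η hη
    rw [hη]
  refine (ENNReal.pow_le_pow_left_iff two_ne_zero).1 ?_
  rw [mul_pow, eLpNorm_two_sq, eLpNorm_two_sq]
  have hpt : ∀ ξ, (∫⁻ η, G η * F (ξ - η)) ^ 2 ≤ (∫⁻ η, G η) * ∫⁻ η, G η * F (ξ - η) ^ 2 := by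
    intro ξ
    have hm : Measurable fun η => F (ξ - η) := hF.comp (by fun_prop)
    have h := lintegral_mul_sq_le (volume.withDensity G) (f := 1) (g := fun η => F (ξ - η))
      aemeasurable_const hm.aemeasurable
    rw [lintegral_withDensity_eq_lintegral_mul _ hG' (by simpa using hm),
      lintegral_withDensity_eq_lintegral_mul _ hG' (by simp),
      lintegral_withDensity_eq_lintegral_mul _ hG' (by fun_prop)] at h
    simpa using h
  calc _ ≤ ∫⁻ ξ, (∫⁻ η, G η) * ∫⁻ η, G η * F (ξ - η) ^ 2 := lintegral_mono hpt
    _ = (∫⁻ η, G η) * ∫⁻ ξ, ∫⁻ η, G η * F (ξ - η) ^ 2 := by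
        rw [lintegral_const_mul]
        exact Measurable.lintegral_prod_right' (f := fun p : ℝ × ℝ => G p.2 * F (p.1 - p.2) ^ 2)
          (by fun_prop)
    _ = (∫⁻ η, G η) * ∫⁻ η, ∫⁻ ξ, G η * F (ξ - η) ^ 2 := by
        rw [lintegral_lintegral_swap]
        exact (by fun_prop :
          Measurable fun p : ℝ × ℝ => G p.2 * F (p.1 - p.2) ^ 2).aemeasurable
    _ = (∫⁻ η, G η) * ∫⁻ η, G η * ∫⁻ ξ, F ξ ^ 2 := by
        congr 2 with η
        rw [lintegral_const_mul _ (by fun_prop), lintegral_sub_right_eq_self (fun ξ => F ξ ^ 2)]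
    _ = _ := by rw [lintegral_mul_const _ hG', sq, mul_assoc]

/-- Minkowski's inequality for countable sums of `ℝ≥0∞`-valued functions. -/
theorem eLpNorm_two_tsum_le {F : ℕ → ℝ → ℝ≥0∞} (hF : ∀ n, Measurable (F n)) :
    eLpNorm (fun ξ => ∑' n, F n ξ) 2 volume ≤ ∑' n, eLpNorm (F n) 2 volume := by
  refine (ENNReal.pow_le_pow_left_iff two_ne_zero).1 ?_
  rw [eLpNorm_two_sq]
  have hsup : ∀ ξ, (∑' n, F n ξ) ^ 2 = ⨆ N, (∑ n ∈ Finset.range N, F n ξ) ^ 2 := fun ξ => by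
    refine tendsto_nhds_unique ?_ (tendsto_atTop_iSup fun a b hab => ?_)
    · exact ((ENNReal.continuous_pow 2).tendsto _).comp ENNReal.summable.hasSum.tendsto_sum_nat
    · exact pow_le_pow_left' (Finset.sum_le_sum_of_subset (by simpa using hab)) 2
  simp_rw [hsup]
  rw [lintegral_iSup (fun N => by fun_prop)
    (fun a b hab ξ => pow_le_pow_left' (Finset.sum_le_sum_of_subset (by simpa using hab)) 2)]
  refine iSup_le fun N => ?_
  have h := eLpNorm_sum_le (μ := volume) (p := 2) (f := F) (s := Finset.range N)
    (fun i _ => (hF i).aestronglyMeasurable) (by norm_num)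
  calc _ = eLpNorm (∑ n ∈ Finset.range N, F n) 2 volume ^ 2 := by
        rw [eLpNorm_two_sq]; simp
    _ ≤ _ := pow_le_pow_left' (h.trans (ENNReal.sum_le_tsum _)) 2

theorem fourier_add_apply {f g : ℝ → ℂ} (hf : Integrable f) (hg : Integrable g) (ξ : ℝ) :
    𝓕 (fun x => f x + g x) ξ = 𝓕 f ξ + 𝓕 g ξ :=
  congrFun (VectorFourier.fourierIntegral_add Real.continuous_fourierChar
    (by exact continuous_inner) hf hg).symm ξ |>.symm

theorem fourier_const_mul_apply (c : ℂ) (f : ℝ → ℂ) (ξ : ℝ) :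
    𝓕 (fun x => c * f x) ξ = c * 𝓕 f ξ :=
  congrFun (VectorFourier.fourierIntegral_const_smul 𝐞 volume (innerₗ ℝ) f c) ξ

theorem fourier_sub_apply {f g : ℝ → ℂ} (hf : Integrable f) (hg : Integrable g) (ξ : ℝ) :
    𝓕 (fun x => f x - g x) ξ = 𝓕 f ξ - 𝓕 g ξ := by
  have h := fourier_add_apply hf (hg.const_mul (-1)) ξ
  rw [fourier_const_mul_apply] at h
  simpa [sub_eq_add_neg] using h

theorem fourierInv_sub_apply {f g : ℝ → ℂ} (hf : Integrable f) (hg : Integrable g) (x : ℝ) :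
    𝓕⁻ (fun ξ => f ξ - g ξ) x = 𝓕⁻ f x - 𝓕⁻ g x := by
  simp_rw [Real.fourierInv_eq_fourier_neg]
  exact fourier_sub_apply hf hg _

theorem fourierInv_const_mul_apply (c : ℂ) (f : ℝ → ℂ) (x : ℝ) :
    𝓕⁻ (fun ξ => c * f ξ) x = c * 𝓕⁻ f x := by
  simp_rw [Real.fourierInv_eq_fourier_neg]
  exact fourier_const_mul_apply c f _

/-- The weight `⟨ξ⟩^σ 2^{sξ}`. -/
noncomputable def expWeight (s σ ξ : ℝ) : ℝ≥0∞ :=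
  ENNReal.ofReal ((1 + ξ ^ 2) ^ (σ / 2) * (2 : ℝ) ^ (s * ξ))

theorem measurable_expWeight (s σ : ℝ) : Measurable (expWeight s σ) := by
  unfold expWeight; fun_prop

theorem expWeight_add_le {s σ : ℝ} (hσ : 0 ≤ σ) (a b : ℝ) :
    expWeight s σ (a + b) ≤ ENNReal.ofReal (2 ^ (σ / 2)) * expWeight s σ a * expWeight s σ b := by
  unfold expWeight
  rw [← ENNReal.ofReal_mul (by positivity), ← ENNReal.ofReal_mul (by positivity)]
  apply ENNReal.ofReal_le_ofReal
  have h : (1 + (a + b) ^ 2) ^ (σ / 2) ≤ 2 ^ (σ / 2) * (1 + a ^ 2) ^ (σ / 2) *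
      (1 + b ^ 2) ^ (σ / 2) := by
    rw [← Real.mul_rpow (by positivity) (by positivity),
      ← Real.mul_rpow (by positivity) (by positivity)]
    exact Real.rpow_le_rpow (by positivity)
      (by nlinarith [sq_nonneg (a - b), sq_nonneg (a * b)]) (by positivity)
  rw [mul_add, Real.rpow_add two_pos]
  calc _ ≤ 2 ^ (σ / 2) * (1 + a ^ 2) ^ (σ / 2) * (1 + b ^ 2) ^ (σ / 2) *
        ((2 : ℝ) ^ (s * a) * 2 ^ (s * b)) := by gcongr
    _ = _ := by ring

/-- The `L²` norm of the Fourier transform of `f` against `expWeight`. -/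
noncomputable def wnormTwo (s σ : ℝ) (f : ℝ → ℂ) : ℝ≥0∞ :=
  eLpNorm (fun ξ => expWeight s σ ξ * ‖𝓕 f ξ‖ₑ) 2 volume

/-- The `L¹` norm of `G` against `expWeight`, normalised to be submultiplicative. -/
noncomputable def wnormOne (s σ : ℝ) (G : ℝ → ℂ) : ℝ≥0∞ :=
  ∫⁻ ξ, ENNReal.ofReal (2 ^ (σ / 2)) * expWeight s σ ξ * ‖G ξ‖ₑ

theorem measurable_expWeight_mul_fourier (s σ : ℝ) {f : ℝ → ℂ} (hf : Integrable f) :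
    Measurable fun ξ => expWeight s σ ξ * ‖𝓕 f ξ‖ₑ :=
  (measurable_expWeight s σ).mul (continuous_fourier hf).enorm.measurable

theorem eLpNorm_two_mono {f g : ℝ → ℝ≥0∞} (h : ∀ x, f x ≤ g x) :
    eLpNorm f 2 volume ≤ eLpNorm g 2 volume :=
  eLpNorm_mono_enorm fun x => by simpa using h x

theorem wnormTwo_add_le (s σ : ℝ) {f g : ℝ → ℂ} (hf : Integrable f) (hg : Integrable g) :
    wnormTwo s σ (fun x => f x + g x) ≤ wnormTwo s σ f + wnormTwo s σ g := by
  refine le_trans (eLpNorm_two_mono fun ξ => ?_) (eLpNorm_add_le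
    (measurable_expWeight_mul_fourier s σ hf).aestronglyMeasurable
    (measurable_expWeight_mul_fourier s σ hg).aestronglyMeasurable (by norm_num))
  rw [fourier_add_apply hf hg, Pi.add_apply, ← mul_add]
  gcongr
  exact enorm_add_le _ _

theorem wnormTwo_mul_le (s : ℝ) {σ : ℝ} (hσ : 0 ≤ σ) {f G : ℝ → ℂ} (hf : Integrable f)
    (hG : Integrable G) :
    wnormTwo s σ (fun x => f x * 𝓕⁻ G x) ≤ wnormOne s σ G * wnormTwo s σ f := by
  have hw := measurable_expWeight s σ
  refine le_trans (eLpNorm_two_mono fun ξ => ?_) (eLpNorm_two_lconvolution_le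
    (measurable_expWeight_mul_fourier s σ hf)
    ((hw.aemeasurable.const_mul _).mul hG.aestronglyMeasurable.enorm))
  rw [fourier_mul_fourierInv hf hG]
  refine (mul_le_mul_right (enorm_integral_le_lintegral_enorm _) _).trans ?_
  rw [← lintegral_const_mul'' _ (by
    have := (continuous_fourier hf).comp (continuous_sub_left ξ)
    exact (hG.aestronglyMeasurable.mul this.aestronglyMeasurable).enorm)]
  refine lintegral_mono fun η => ?_
  have h := expWeight_add_le (s := s) hσ η (ξ - η)
  rw [add_sub_cancel] at h
  calc _ ≤ ENNReal.ofReal (2 ^ (σ / 2)) * expWeight s σ η * expWeight s σ (ξ - η) *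
        ‖G η * 𝓕 f (ξ - η)‖ₑ := mul_le_mul_left h _
    _ = _ := by rw [enorm_mul]; ring

theorem Integrable.mul_fourierInv_pow {f G : ℝ → ℂ} (hf : Integrable f) (hG : Integrable G)
    (n : ℕ) : Integrable (fun x => f x * 𝓕⁻ G x ^ n) := by
  induction n with
  | zero => simpa using hf
  | succ n ih => simpa only [pow_succ, mul_assoc] using Integrable.mul_fourierInv ih hG

theorem wnormTwo_mul_pow_le (s : ℝ) {σ : ℝ} (hσ : 0 ≤ σ) {f G : ℝ → ℂ} (hf : Integrable f)
    (hG : Integrable G) (n : ℕ) :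
    wnormTwo s σ (fun x => f x * 𝓕⁻ G x ^ n) ≤ wnormOne s σ G ^ n * wnormTwo s σ f := by
  induction n with
  | zero => simp
  | succ n ih =>
    have h := wnormTwo_mul_le s hσ (Integrable.mul_fourierInv_pow hf hG n) hG
    simp only [mul_assoc, ← pow_succ] at h
    refine h.trans ?_
    rw [pow_succ', mul_assoc]
    gcongr

theorem wnormTwo_mul_pow_sub_le (s : ℝ) {σ : ℝ} (hσ : 0 ≤ σ) {f g F G : ℝ → ℂ} {R : ℝ≥0∞}
    (hf : Integrable f) (hg : Integrable g) (hF : Integrable F) (hG : Integrable G)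
    (hFR : wnormOne s σ F ≤ R) (hGR : wnormOne s σ G ≤ R) (n : ℕ) :
    wnormTwo s σ (fun x => f x * 𝓕⁻ F x ^ n - g x * 𝓕⁻ G x ^ n) ≤
      R ^ n * wnormTwo s σ (fun x => f x - g x) +
        n * R ^ (n - 1) * (wnormTwo s σ g * wnormOne s σ (fun ξ => F ξ - G ξ)) := by
  induction n with
  | zero => simp
  | succ n ih =>
    have hfn := Integrable.mul_fourierInv_pow hf hF n
    have hgn := Integrable.mul_fourierInv_pow hg hG n
    have hFG : Integrable fun ξ => F ξ - G ξ := hF.sub hG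
    have heq : (fun x => f x * 𝓕⁻ F x ^ (n + 1) - g x * 𝓕⁻ G x ^ (n + 1)) = fun x =>
        (f x * 𝓕⁻ F x ^ n - g x * 𝓕⁻ G x ^ n) * 𝓕⁻ F x +
          (g x * 𝓕⁻ G x ^ n) * 𝓕⁻ (fun ξ => F ξ - G ξ) x := by
      ext x
      rw [fourierInv_sub_apply hF hG]
      ring
    rw [heq]
    refine (wnormTwo_add_le s σ (Integrable.mul_fourierInv (hfn.sub hgn) hF)
      (Integrable.mul_fourierInv hgn hFG)).trans ?_
    have h1 := wnormTwo_mul_le s hσ (hfn.sub hgn) hF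
    have h2 := wnormTwo_mul_le s hσ hgn hFG
    have h3 := wnormTwo_mul_pow_le s hσ hg hG n
    have hcase : R * (n * R ^ (n - 1)) = n * R ^ n := by
      rcases n with _ | n
      · simp
      · simp [pow_succ]; ring
    calc _ ≤ R * (R ^ n * wnormTwo s σ (fun x => f x - g x) +
          n * R ^ (n - 1) * (wnormTwo s σ g * wnormOne s σ (fun ξ => F ξ - G ξ))) +
          wnormOne s σ (fun ξ => F ξ - G ξ) * (R ^ n * wnormTwo s σ g) := by
          gcongr
          · exact h1.trans (by gcongr; exact ih)
          · exact h2.trans (by gcongr; exact h3.trans (by gcongr))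
      _ = R * R ^ n * wnormTwo s σ (fun x => f x - g x) + (R * (n * R ^ (n - 1)) + R ^ n) *
          (wnormTwo s σ g * wnormOne s σ (fun ξ => F ξ - G ξ)) := by ring
      _ = _ := by
          rw [hcase]
          push_cast
          ring

theorem summable_integral_norm_mul_pow {f G : ℝ → ℂ} (hf : Integrable f) (hG : Integrable G) :
    Summable fun n : ℕ => ∫ x, ‖(n.factorial : ℂ)⁻¹ * (f x * 𝓕⁻ G x ^ n)‖ := by
  refine Summable.of_nonneg_of_le (fun n => integral_nonneg fun x => norm_nonneg _) (fun n => ?_)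
    ((Real.summable_pow_div_factorial (∫ η, ‖G η‖)).mul_right (∫ x, ‖f x‖))
  rw [← integral_const_mul]
  refine integral_mono ((Integrable.mul_fourierInv_pow hf hG n).const_mul _).norm
    (hf.norm.const_mul _) fun x => ?_
  have h := pow_le_pow_left₀ (norm_nonneg _) (norm_fourierInv_le G x) n
  simp only [norm_mul, norm_inv, norm_pow, Complex.norm_natCast]
  calc _ ≤ (n.factorial : ℝ)⁻¹ * (‖f x‖ * (∫ η, ‖G η‖) ^ n) := by gcongr
    _ = _ := by ring

theorem hasSum_fourier {P : ℕ → ℝ → ℂ} {p : ℝ → ℂ} (hP : ∀ n, Integrable (P n))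
    (hsum : Summable fun n => ∫ x, ‖P n x‖) (hp : ∀ x, HasSum (fun n => P n x) (p x)) (ξ : ℝ) :
    HasSum (fun n => 𝓕 (P n) ξ) (𝓕 p ξ) := by
  have h := hasSum_integral_of_summable_integral_norm (F := fun n x => 𝐞 (-(x * ξ)) • P n x)
    (fun n => by simpa [mul_comm] using (Real.fourierIntegral_convergent_iff (f := P n) ξ).2 (hP n))
    (by simpa using hsum)
  have heq : 𝓕 p ξ = ∫ x, ∑' n, 𝐞 (-(x * ξ)) • P n x := by
    rw [Real.fourier_real_eq]
    congr 1 with x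
    exact ((hp x).const_smul (𝐞 (-(x * ξ)) : ℂ)).tsum_eq.symm
  simp only [Real.fourier_real_eq (P _)]
  rwa [heq]

theorem tsum_ofReal_pow_div_factorial {r : ℝ} (hr : 0 ≤ r) :
    ∑' n : ℕ, (n.factorial : ℝ≥0∞)⁻¹ * ENNReal.ofReal r ^ n = ENNReal.ofReal (Real.exp r) := by
  rw [Real.exp_eq_exp_ℝ, NormedSpace.exp_eq_tsum_div,
    ENNReal.ofReal_tsum_of_nonneg (fun n => by positivity) (Real.summable_pow_div_factorial r)]
  congr 1 with n
  rw [ENNReal.ofReal_div_of_pos (by positivity), ENNReal.ofReal_pow hr, ENNReal.ofReal_natCast,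
    ENNReal.div_eq_inv_mul]

theorem tsum_deriv_ofReal_pow_div_factorial {r : ℝ} (hr : 0 ≤ r) :
    ∑' n : ℕ, (n.factorial : ℝ≥0∞)⁻¹ * (n * ENNReal.ofReal r ^ (n - 1)) =
      ENNReal.ofReal (Real.exp r) := by
  rw [tsum_eq_zero_add' ENNReal.summable, ← tsum_ofReal_pow_div_factorial hr]
  simp only [Nat.cast_zero, zero_mul, mul_zero, zero_add, Nat.add_sub_cancel]
  congr 1 with n
  rw [Nat.factorial_succ, Nat.cast_mul, ENNReal.mul_inv (by simp) (by simp)]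
  calc _ = ((n + 1 : ℕ) : ℝ≥0∞)⁻¹ * ((n + 1 : ℕ) : ℝ≥0∞) *
        ((n.factorial : ℝ≥0∞)⁻¹ * ENNReal.ofReal r ^ n) := by ring
    _ = _ := by rw [ENNReal.inv_mul_cancel (by simp) (by simp), one_mul]

theorem wnormTwo_mul_exp_sub_le (s : ℝ) {σ : ℝ} (hσ : 0 ≤ σ) {f g F G : ℝ → ℂ} {r : ℝ}
    (hr : 0 ≤ r) (hf : Integrable f) (hg : Integrable g) (hF : Integrable F) (hG : Integrable G)
    (hFr : wnormOne s σ F ≤ ENNReal.ofReal r) (hGr : wnormOne s σ G ≤ ENNReal.ofReal r) :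
    wnormTwo s σ (fun x => f x * Complex.exp (𝓕⁻ F x) - g x * Complex.exp (𝓕⁻ G x)) ≤
      ENNReal.ofReal (Real.exp r) * (wnormTwo s σ (fun x => f x - g x) +
        wnormTwo s σ g * wnormOne s σ (fun ξ => F ξ - G ξ)) := by
  have hexp : ∀ z : ℂ, HasSum (fun n : ℕ => (n.factorial : ℂ)⁻¹ * z ^ n) (Complex.exp z) :=
    fun z => by
      rw [Complex.exp_eq_exp_ℂ]
      simpa using NormedSpace.exp_series_hasSum_exp' (𝕂 := ℂ) z
  have hfn := Integrable.mul_fourierInv_pow hf hF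
  have hgn := Integrable.mul_fourierInv_pow hg hG
  set p : ℕ → ℝ → ℂ := fun n x => f x * 𝓕⁻ F x ^ n - g x * 𝓕⁻ G x ^ n with hp
  have hpint : ∀ n, Integrable (p n) := fun n => (hfn n).sub (hgn n)
  have hsum : Summable fun n : ℕ => ∫ x, ‖(n.factorial : ℂ)⁻¹ * p n x‖ := by
    refine Summable.of_nonneg_of_le (fun n => integral_nonneg fun x => norm_nonneg _) (fun n => ?_)
      ((summable_integral_norm_mul_pow hf hF).add (summable_integral_norm_mul_pow hg hG))
    rw [← integral_add ((hfn n).const_mul _).norm ((hgn n).const_mul _).norm]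
    refine integral_mono ((hpint n).const_mul _).norm
      (((hfn n).const_mul _).norm.add ((hgn n).const_mul _).norm) fun x => ?_
    change ‖_ * (_ - _)‖ ≤ _
    rw [mul_sub]
    exact norm_sub_le _ _
  have hser := hasSum_fourier (P := fun n x => (n.factorial : ℂ)⁻¹ * p n x)
    (p := fun x => f x * Complex.exp (𝓕⁻ F x) - g x * Complex.exp (𝓕⁻ G x))
    (fun n => (hpint n).const_mul _) hsum (fun x => by
      have h := ((hexp (𝓕⁻ F x)).mul_left (f x)).sub ((hexp (𝓕⁻ G x)).mul_left (g x))
      have e : (fun n : ℕ => (n.factorial : ℂ)⁻¹ * p n x) = fun n : ℕ =>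
          f x * ((n.factorial : ℂ)⁻¹ * 𝓕⁻ F x ^ n) - g x * ((n.factorial : ℂ)⁻¹ * 𝓕⁻ G x ^ n) :=
        funext fun n => by
          change (n.factorial : ℂ)⁻¹ * (f x * 𝓕⁻ F x ^ n - g x * 𝓕⁻ G x ^ n) = _
          ring
      rw [e]
      exact h)
  have hmeas := fun n => measurable_expWeight_mul_fourier s σ (hpint n)
  calc wnormTwo s σ (fun x => f x * Complex.exp (𝓕⁻ F x) - g x * Complex.exp (𝓕⁻ G x))
      ≤ eLpNorm (fun ξ => ∑' n : ℕ, (n.factorial : ℝ≥0∞)⁻¹ * (expWeight s σ ξ * ‖𝓕 (p n) ξ‖ₑ))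
          2 volume := by
        refine eLpNorm_two_mono fun ξ => ?_
        rw [← (hser ξ).tsum_eq]
        refine (mul_le_mul_right enorm_tsum_le_tsum_enorm _).trans_eq ?_
        rw [← ENNReal.tsum_mul_left]
        congr 1 with n
        rw [fourier_const_mul_apply, enorm_mul, enorm_inv (by simp [Nat.factorial_ne_zero])]
        simp only [enorm_eq_nnnorm, Complex.nnnorm_natCast]
        push_cast
        ring
    _ ≤ ∑' n : ℕ, eLpNorm (fun ξ => (n.factorial : ℝ≥0∞)⁻¹ *
          (expWeight s σ ξ * ‖𝓕 (p n) ξ‖ₑ)) 2 volume :=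
        eLpNorm_two_tsum_le fun n => (hmeas n).const_mul _
    _ = ∑' n : ℕ, (n.factorial : ℝ≥0∞)⁻¹ * wnormTwo s σ (p n) := by
        congr 1 with n
        refine (ENNReal.pow_right_strictMono two_ne_zero).injective ?_
        simp only [wnormTwo, mul_pow, eLpNorm_two_sq]
        exact lintegral_const_mul' _ _ (by simp [Nat.factorial_ne_zero])
    _ ≤ ∑' n : ℕ, ((n.factorial : ℝ≥0∞)⁻¹ * ENNReal.ofReal r ^ n *
          wnormTwo s σ (fun x => f x - g x) +
          (n.factorial : ℝ≥0∞)⁻¹ * (n * ENNReal.ofReal r ^ (n - 1)) *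
          (wnormTwo s σ g * wnormOne s σ (fun ξ => F ξ - G ξ))) := by
        refine ENNReal.tsum_le_tsum fun n => ?_
        refine (mul_le_mul_right (wnormTwo_mul_pow_sub_le s hσ hf hg hF hG hFr hGr n) _).trans_eq ?_
        ring
    _ = _ := by
        rw [ENNReal.tsum_add, ENNReal.tsum_mul_right, ENNReal.tsum_mul_right,
          tsum_ofReal_pow_div_factorial hr, tsum_deriv_ofReal_pow_div_factorial hr]
        ring

open Filter Topology in
/-- On functions with Fourier support away from `0`, `pinv` is the Fourier multiplier
`1 / (2πiξ)`. -/
theorem pinv_fourierInv {ε₀ : ℝ} (hε : 0 < ε₀) {B : ℝ → ℂ} (hB : Integrable B)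
    (hB0 : ∀ ξ < ε₀, B ξ = 0) (hB' : Integrable (𝓕⁻ B))
    (hG : Integrable fun ξ : ℝ => B ξ / (2 * π * Complex.I * ξ)) (x : ℝ) :
    pinv (𝓕⁻ B) x = 𝓕⁻ (fun ξ : ℝ => B ξ / (2 * π * Complex.I * ξ)) x := by
  set G : ℝ → ℂ := fun ξ => B ξ / (2 * π * Complex.I * ξ)
  have hGB : ∀ ξ : ℝ, 2 * π * Complex.I * ξ * G ξ = B ξ := fun ξ => by
    rcases lt_or_ge ξ ε₀ with h | h
    · simp [G, hB0 ξ h]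
    · have : (ξ : ℂ) ≠ 0 := by exact_mod_cast (hε.trans_le h).ne'
      have hπ : (π : ℂ) ≠ 0 := by exact_mod_cast Real.pi_ne_zero
      simp only [G]
      field_simp
  have hxG : Integrable fun ξ : ℝ => ξ • G ξ := by
    convert hB.const_mul (2 * π * Complex.I)⁻¹ using 2 with ξ
    have hπ : (π : ℂ) ≠ 0 := by exact_mod_cast Real.pi_ne_zero
    rw [← hGB, Complex.real_smul]
    field_simp
  have hderiv : ∀ y, HasDerivAt (𝓕⁻ G) (𝓕⁻ B y) y := fun y => by
    have h := (Real.hasDerivAt_fourier hG hxG (-y)).scomp y (hasDerivAt_neg y)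
    have h1 : 𝓕⁻ G = 𝓕 G ∘ Neg.neg := funext (Real.fourierInv_eq_fourier_neg G)
    have h2 : 𝓕⁻ B y = (-1 : ℝ) • 𝓕 (fun ξ : ℝ => (-2 * π * Complex.I * ξ) • G ξ) (-y) := by
      have h3 := fourier_const_mul_apply (-1) (fun ξ : ℝ => (-2 * π * Complex.I * ξ) • G ξ) (-y)
      rw [neg_one_mul] at h3
      rw [Real.fourierInv_eq_fourier_neg, neg_one_smul, ← h3]
      refine congrArg (fun f : ℝ → ℂ => 𝓕 f (-y)) (funext fun ξ => ?_)
      rw [← hGB, smul_eq_mul]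
      ring
    rw [h1, h2]
    exact h
  have hlim : Tendsto (𝓕⁻ G) (cocompact ℝ) (𝓝 0) := by
    rw [Real.fourierInv_eq_fourier_comp_neg]
    exact Real.zero_at_infty_fourier _
  have h1 := integral_Iic_of_hasDerivAt_of_tendsto' (a := x) (fun y _ => hderiv y)
    hB'.integrableOn (hlim.mono_left atBot_le_cocompact)
  have h2 := integral_Ioi_of_hasDerivAt_of_tendsto' (a := x) (fun y _ => hderiv y)
    hB'.integrableOn (hlim.mono_left atTop_le_cocompact)
  rw [pinv, h1, integral_Ici_eq_integral_Ioi, h2]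
  ring

/-- Continuous integrable functions with integrable Fourier transform supported in `[ε₀, ∞)`. -/
structure FreqGE (ε₀ : ℝ) (w : ℝ → ℂ) : Prop where
  continuous : Continuous w
  integrable : Integrable w
  integrable_fourier : Integrable (𝓕 w)
  fourier_eq_zero : ∀ ξ < ε₀, 𝓕 w ξ = 0

theorem FreqGE.sub {ε₀ : ℝ} {p q : ℝ → ℂ} (hp : FreqGE ε₀ p) (hq : FreqGE ε₀ q) :
    FreqGE ε₀ (fun x => p x - q x) where
  continuous := hp.continuous.sub hq.continuous
  integrable := hp.integrable.sub hq.integrable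
  integrable_fourier := by
    have h : 𝓕 (fun x => p x - q x) = fun ξ => 𝓕 p ξ - 𝓕 q ξ :=
      funext (fourier_sub_apply hp.integrable hq.integrable)
    rw [h]
    exact hp.integrable_fourier.sub hq.integrable_fourier
  fourier_eq_zero ξ hξ := by
    rw [fourier_sub_apply hp.integrable hq.integrable, hp.fourier_eq_zero ξ hξ,
      hq.fourier_eq_zero ξ hξ, sub_zero]

/-- The product `p q*`, where `q*(x) = conj (q (-x))`. -/
noncomputable def mulRefl (p q : ℝ → ℂ) (x : ℝ) : ℂ := p x * (starRingEnd ℂ) (q (-x))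

theorem FreqGE.conj_neg {ε₀ : ℝ} {q : ℝ → ℂ} (hq : FreqGE ε₀ q) (x : ℝ) :
    (starRingEnd ℂ) (q (-x)) = 𝓕⁻ (fun ξ => (starRingEnd ℂ) (𝓕 q ξ)) x := by
  rw [← congrFun (hq.continuous.fourierInv_fourier_eq hq.integrable hq.integrable_fourier) (-x),
    Real.fourierInv_eq, Real.fourierInv_eq, ← integral_conj]
  congr 1 with ξ
  simp [Circle.smul_def, ← Circle.coe_inv_eq_conj, ← AddChar.map_neg_eq_inv]

theorem FreqGE.integrable_conj_fourier {ε₀ : ℝ} {q : ℝ → ℂ} (hq : FreqGE ε₀ q) :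
    Integrable fun ξ => (starRingEnd ℂ) (𝓕 q ξ) :=
  (LinearIsometryEquiv.integrable_comp_iff Complex.conjLIE).2 hq.integrable_fourier

theorem FreqGE.mulRefl_eq {ε₀ : ℝ} {p q : ℝ → ℂ} (hq : FreqGE ε₀ q) :
    mulRefl p q = fun x => p x * 𝓕⁻ (fun ξ => (starRingEnd ℂ) (𝓕 q ξ)) x :=
  funext fun x => by rw [mulRefl, hq.conj_neg]

theorem integrable_mulRefl {ε₀ : ℝ} {p q : ℝ → ℂ} (hp : FreqGE ε₀ p) (hq : FreqGE ε₀ q) :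
    Integrable (mulRefl p q) := by
  rw [hq.mulRefl_eq]
  exact Integrable.mul_fourierInv hp.integrable hq.integrable_conj_fourier

theorem fourier_mulRefl {ε₀ : ℝ} {p q : ℝ → ℂ} (hp : FreqGE ε₀ p) (hq : FreqGE ε₀ q)
    (ξ : ℝ) :
    𝓕 (mulRefl p q) ξ = ∫ η, (starRingEnd ℂ) (𝓕 q η) * 𝓕 p (ξ - η) := by
  rw [hq.mulRefl_eq]
  exact fourier_mul_fourierInv hp.integrable hq.integrable_conj_fourier ξ

theorem enorm_fourier_mulRefl_le {ε₀ : ℝ} {p q : ℝ → ℂ} (hp : FreqGE ε₀ p) (hq : FreqGE ε₀ q)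
    (ξ : ℝ) :
    ‖𝓕 (mulRefl p q) ξ‖ₑ ≤ ∫⁻ η, ‖𝓕 q η‖ₑ * ‖𝓕 p (ξ - η)‖ₑ := by
  rw [fourier_mulRefl hp hq]
  refine (enorm_integral_le_lintegral_enorm _).trans_eq ?_
  congr 1 with η
  rw [enorm_mul, RCLike.enorm_conj]

theorem integrable_fourier_mulRefl {ε₀ : ℝ} {p q : ℝ → ℂ} (hp : FreqGE ε₀ p) (hq : FreqGE ε₀ q) :
    Integrable (𝓕 (mulRefl p q)) := by
  have h := hq.integrable_conj_fourier.integrable_convolution (ContinuousLinearMap.mul ℂ ℂ)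
    hp.integrable_fourier
  convert h using 1
  exact funext fun ξ => fourier_mulRefl hp hq ξ

theorem fourier_mulRefl_eq_zero {ε₀ : ℝ} {p q : ℝ → ℂ} (hp : FreqGE ε₀ p) (hq : FreqGE ε₀ q)
    (hε : 0 < ε₀) {ξ : ℝ} (hξ : ξ < ε₀) :
    𝓕 (mulRefl p q) ξ = 0 := by
  rw [fourier_mulRefl hp hq]
  refine integral_eq_zero_of_ae (.of_forall fun η => ?_)
  rcases lt_or_ge η ε₀ with h | h
  · simp [hq.fourier_eq_zero η h]
  · simp [hp.fourier_eq_zero (ξ - η) (by linarith)]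

theorem norm_two_pi_I_mul {ξ : ℝ} (hξ : 0 ≤ ξ) : ‖2 * π * Complex.I * (ξ : ℂ)‖ = 2 * π * ξ := by
  simp [abs_of_pos Real.pi_pos, abs_of_nonneg hξ]

/-- The Fourier transform of `∂ₓ⁻¹ (p q*)`. -/
noncomputable def gaugeSymbol (p q : ℝ → ℂ) (ξ : ℝ) : ℂ :=
  𝓕 (mulRefl p q) ξ / (2 * π * Complex.I * ξ)

theorem integrable_gaugeSymbol {ε₀ : ℝ} (hε : 0 < ε₀) {p q : ℝ → ℂ} (hp : FreqGE ε₀ p)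
    (hq : FreqGE ε₀ q) : Integrable (gaugeSymbol p q) := by
  have hB := integrable_fourier_mulRefl hp hq
  refine (hB.norm.const_mul (2 * π * ε₀)⁻¹).mono' ?_ (.of_forall fun ξ => ?_)
  · have h : Measurable fun ξ : ℝ => 2 * π * Complex.I * (ξ : ℂ) := by fun_prop
    exact (hB.aestronglyMeasurable.aemeasurable.div h.aemeasurable).aestronglyMeasurable
  · rcases lt_or_ge ξ ε₀ with h | h
    · simp [gaugeSymbol, fourier_mulRefl_eq_zero hp hq hε h]
    · rw [gaugeSymbol, norm_div, norm_two_pi_I_mul (hε.le.trans h), div_eq_inv_mul]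
      gcongr

theorem pinv_mulRefl {ε₀ : ℝ} (hε : 0 < ε₀) {w : ℝ → ℂ} (hw : FreqGE ε₀ w) (x : ℝ) :
    pinv (mulRefl w w) x = 𝓕⁻ (gaugeSymbol w w) x := by
  have hc : Continuous (mulRefl w w) :=
    hw.continuous.mul (Complex.continuous_conj.comp (hw.continuous.comp continuous_neg))
  have hinv := hc.fourierInv_fourier_eq (integrable_mulRefl hw hw) (integrable_fourier_mulRefl hw hw)
  have h := pinv_fourierInv hε (integrable_fourier_mulRefl hw hw)
    (fun ξ => fourier_mulRefl_eq_zero hw hw hε) (by rw [hinv]; exact integrable_mulRefl hw hw)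
    (integrable_gaugeSymbol hε hw hw) x
  rwa [hinv] at h

theorem gaugeT_eq {ε₀ : ℝ} (hε : 0 < ε₀) (δ : ℝ) {w : ℝ → ℂ} (hw : FreqGE ε₀ w) (x : ℝ) :
    gaugeT δ w x = w x * Complex.exp (𝓕⁻ (fun ξ => -(δ : ℂ) * gaugeSymbol w w ξ) x) := by
  rw [fourierInv_const_mul_apply, ← pinv_mulRefl hε hw]
  rfl

theorem gaugeSymbol_sub {ε₀ : ℝ} {p q : ℝ → ℂ} (hp : FreqGE ε₀ p) (hq : FreqGE ε₀ q) (ξ : ℝ) :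
    gaugeSymbol p p ξ - gaugeSymbol q q ξ =
      gaugeSymbol (fun x => p x - q x) p ξ + gaugeSymbol q (fun x => p x - q x) ξ := by
  simp only [gaugeSymbol]
  rw [← sub_div, ← add_div,
    ← fourier_sub_apply (integrable_mulRefl hp hp) (integrable_mulRefl hq hq),
    ← fourier_add_apply (integrable_mulRefl (hp.sub hq) hp) (integrable_mulRefl hq (hp.sub hq))]
  congr 1
  refine congrArg (fun f : ℝ → ℂ => 𝓕 f ξ) (funext fun x => ?_)
  simp only [mulRefl, map_sub]
  ring

/-- The square root of the integrable weight used in the bilinear estimate. -/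
noncomputable def tailWeight (ε₀ τ η : ℝ) : ℝ≥0∞ :=
  (Set.Ici ε₀).indicator (fun η : ℝ => ENNReal.ofReal (η ^ (-((1 + τ) / 2)))) η

theorem measurable_tailWeight (ε₀ τ : ℝ) : Measurable (tailWeight ε₀ τ) :=
  Measurable.indicator (by fun_prop) measurableSet_Ici

theorem lintegral_tailWeight_sq_lt_top {ε₀ τ : ℝ} (hε : 0 < ε₀) (hτ : 0 < τ) :
    ∫⁻ η, tailWeight ε₀ τ η ^ 2 < ∞ := by
  have h : ∀ η, tailWeight ε₀ τ η ^ 2 =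
      (Set.Ici ε₀).indicator (fun η : ℝ => ENNReal.ofReal (η ^ (-(1 + τ)))) η := fun η => by
    by_cases hη : η ∈ Set.Ici ε₀
    · have h0 : 0 < η := hε.trans_le hη
      rw [tailWeight, Set.indicator_of_mem hη, Set.indicator_of_mem hη,
        ← ENNReal.ofReal_pow (by positivity), ← Real.rpow_mul_natCast h0.le]
      congr 2
      push_cast
      ring
    · simp [tailWeight, Set.indicator_of_notMem hη]
  simp_rw [h]
  rw [lintegral_indicator measurableSet_Ici, setLIntegral_congr Ioi_ae_eq_Ici.symm]
  exact ((integrableOn_Ioi_rpow_of_lt (by linarith) hε).integrable.lintegral_lt_top)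

theorem rpow_add_div_add_le {σ : ℝ} (hσ : 0 < σ) {x y : ℝ} (hx : 0 < x) (hy : 0 < y) :
    (1 + (x + y) ^ 2) ^ (σ / 2) * (x + y)⁻¹ ≤ 2 ^ σ *
      ((1 + x ^ 2) ^ (σ / 2) * x ^ (-((1 + min σ 1) / 2))) *
      ((1 + y ^ 2) ^ (σ / 2) * y ^ (-((1 + min σ 1) / 2))) := by
  wlog hxy : x ≤ y generalizing x y
  · have h := this hy hx (le_of_not_ge hxy)
    rw [add_comm y x] at h
    linarith
  set τ := min σ 1
  have hτ0 : 0 < τ := lt_min hσ one_pos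
  have hτσ : τ ≤ σ := min_le_left _ _
  have hτ1 : τ ≤ 1 := min_le_right _ _
  have h1 : (1 + (x + y) ^ 2) ^ (σ / 2) ≤ 2 ^ σ * (1 + y ^ 2) ^ (σ / 2) := by
    have h4 : (2 : ℝ) ^ σ = 4 ^ (σ / 2) := by
      rw [show (4 : ℝ) = 2 ^ (2 : ℝ) by norm_num, ← Real.rpow_mul two_pos.le]
      congr 1; ring
    rw [h4, ← Real.mul_rpow (by positivity) (by positivity)]
    exact Real.rpow_le_rpow (by positivity) (by nlinarith) (by positivity)
  have h2 : x ^ τ ≤ (1 + x ^ 2) ^ (σ / 2) := by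
    calc x ^ τ = (x ^ 2) ^ (τ / 2) := by
          rw [← Real.rpow_natCast_mul hx.le]; congr 1; push_cast; ring
      _ ≤ (1 + x ^ 2) ^ (τ / 2) := Real.rpow_le_rpow (by positivity) (by linarith) (by positivity)
      _ ≤ _ := Real.rpow_le_rpow_of_exponent_le (by nlinarith) (by linarith)
  have h3 : x ^ ((1 - τ) / 2) * y ^ ((1 + τ) / 2) ≤ x + y := by
    calc _ ≤ (x + y) ^ ((1 - τ) / 2) * (x + y) ^ ((1 + τ) / 2) := by
          gcongr <;> linarith
      _ = x + y := by
          rw [← Real.rpow_add (by positivity), show (1 - τ) / 2 + (1 + τ) / 2 = 1 by ring,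
            Real.rpow_one]
  have h5 : (x + y)⁻¹ ≤ (1 + x ^ 2) ^ (σ / 2) * x ^ (-((1 + τ) / 2)) * y ^ (-((1 + τ) / 2)) := by
    calc (x + y)⁻¹ ≤ (x ^ ((1 - τ) / 2) * y ^ ((1 + τ) / 2))⁻¹ := by gcongr
      _ = x ^ τ * x ^ (-((1 + τ) / 2)) * y ^ (-((1 + τ) / 2)) := by
          rw [mul_inv, ← Real.rpow_neg hx.le, ← Real.rpow_neg hy.le, ← Real.rpow_add hx]
          congr 2
          ring
      _ ≤ _ := by gcongr
  calc _ ≤ (2 ^ σ * (1 + y ^ 2) ^ (σ / 2)) *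
        ((1 + x ^ 2) ^ (σ / 2) * x ^ (-((1 + τ) / 2)) * y ^ (-((1 + τ) / 2))) := by gcongr
    _ = _ := by ring

theorem expWeight_add_div_le (s : ℝ) {σ ε₀ : ℝ} (hσ : 0 < σ) (hε : 0 < ε₀) {x y : ℝ}
    (hx : ε₀ ≤ x) (hy : ε₀ ≤ y) :
    expWeight s σ (x + y) * ENNReal.ofReal (x + y)⁻¹ ≤ ENNReal.ofReal (2 ^ σ) *
      (tailWeight ε₀ (min σ 1) x * expWeight s σ x) *
      (tailWeight ε₀ (min σ 1) y * expWeight s σ y) := by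
  have hx0 := hε.trans_le hx
  have hy0 := hε.trans_le hy
  rw [tailWeight, tailWeight, Set.indicator_of_mem (Set.mem_Ici.2 hx),
    Set.indicator_of_mem (Set.mem_Ici.2 hy)]
  simp only [expWeight]
  rw [← ENNReal.ofReal_mul (by positivity), ← ENNReal.ofReal_mul (by positivity),
    ← ENNReal.ofReal_mul (by positivity), ← ENNReal.ofReal_mul (by positivity),
    ← ENNReal.ofReal_mul (by positivity)]
  apply ENNReal.ofReal_le_ofReal
  rw [mul_add, Real.rpow_add two_pos]
  have h := mul_le_mul_of_nonneg_right (rpow_add_div_add_le hσ hx0 hy0)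
    (by positivity : 0 ≤ (2 : ℝ) ^ (s * x) * 2 ^ (s * y))
  linarith

theorem lintegral_tailWeight_mul_le (s σ ε₀ τ : ℝ) {p : ℝ → ℂ} (hp : Integrable p) :
    (∫⁻ η, tailWeight ε₀ τ η * (expWeight s σ η * ‖𝓕 p η‖ₑ)) ^ 2 ≤
      (∫⁻ η, tailWeight ε₀ τ η ^ 2) * wnormTwo s σ p ^ 2 := by
  rw [wnormTwo, eLpNorm_two_sq]
  exact lintegral_mul_sq_le _ (measurable_tailWeight ε₀ τ).aemeasurable
    (measurable_expWeight_mul_fourier s σ hp).aemeasurable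

theorem wnormOne_gaugeSymbol_le (s : ℝ) {σ ε₀ : ℝ} (hσ : 0 < σ) (hε : 0 < ε₀) {p q : ℝ → ℂ}
    (hp : FreqGE ε₀ p) (hq : FreqGE ε₀ q) :
    wnormOne s σ (gaugeSymbol p q) ≤
      ENNReal.ofReal (2 ^ (σ / 2)) * ENNReal.ofReal (2 ^ σ) *
        (∫⁻ η, tailWeight ε₀ (min σ 1) η ^ 2) * (wnormTwo s σ p * wnormTwo s σ q) := by
  set Φ : (ℝ → ℂ) → ℝ → ℝ≥0∞ := fun f η =>
    tailWeight ε₀ (min σ 1) η * (expWeight s σ η * ‖𝓕 f η‖ₑ)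
  have hm : ∀ {f : ℝ → ℂ}, Integrable f → Measurable (Φ f) := fun hf =>
    (measurable_tailWeight ε₀ _).mul (measurable_expWeight_mul_fourier s σ hf)
  have hΦp := hm hp.integrable
  have hΦq := hm hq.integrable
  set κ := ENNReal.ofReal (2 ^ (σ / 2))
  set c := ENNReal.ofReal (2 ^ σ)
  have hpt : ∀ ξ, κ * expWeight s σ ξ * ‖gaugeSymbol p q ξ‖ₑ ≤
      κ * c * ∫⁻ η, Φ q η * Φ p (ξ - η) := by
    intro ξ
    rcases lt_or_ge ξ ε₀ with h | h
    · simp [gaugeSymbol, fourier_mulRefl_eq_zero hp hq hε h]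
    have hξ := hε.trans_le h
    have hnorm : ‖gaugeSymbol p q ξ‖ₑ ≤
        ENNReal.ofReal ξ⁻¹ * ∫⁻ η, ‖𝓕 q η‖ₑ * ‖𝓕 p (ξ - η)‖ₑ := by
      calc ‖gaugeSymbol p q ξ‖ₑ = ENNReal.ofReal (2 * π * ξ)⁻¹ * ‖𝓕 (mulRefl p q) ξ‖ₑ := by
            rw [gaugeSymbol, ← ofReal_norm, norm_div, norm_two_pi_I_mul hξ.le, div_eq_inv_mul,
              ENNReal.ofReal_mul (by positivity), ofReal_norm]
        _ ≤ _ := by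
            gcongr
            · nlinarith [Real.pi_gt_three]
            · exact enorm_fourier_mulRefl_le hp hq ξ
    calc _ ≤ κ * expWeight s σ ξ * (ENNReal.ofReal ξ⁻¹ *
          ∫⁻ η, ‖𝓕 q η‖ₑ * ‖𝓕 p (ξ - η)‖ₑ) := by gcongr
      _ = κ * ∫⁻ η, (expWeight s σ ξ * ENNReal.ofReal ξ⁻¹) * (‖𝓕 q η‖ₑ * ‖𝓕 p (ξ - η)‖ₑ) := by
          rw [lintegral_const_mul' (expWeight s σ ξ * ENNReal.ofReal ξ⁻¹) _
            (by exact ENNReal.mul_ne_top ENNReal.ofReal_ne_top ENNReal.ofReal_ne_top)]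
          ring
      _ ≤ κ * ∫⁻ η, c * (Φ q η * Φ p (ξ - η)) := by
          refine mul_le_mul_right (lintegral_mono fun η => ?_) κ
          change _ * (_ * _) ≤ c * (tailWeight ε₀ (min σ 1) η * (expWeight s σ η * ‖𝓕 q η‖ₑ) *
            (tailWeight ε₀ (min σ 1) (ξ - η) * (expWeight s σ (ξ - η) * ‖𝓕 p (ξ - η)‖ₑ)))
          rcases lt_or_ge η ε₀ with hη | hη
          · simp [hq.fourier_eq_zero η hη]
          rcases lt_or_ge (ξ - η) ε₀ with hη' | hη'
          · simp [hp.fourier_eq_zero _ hη']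
          have h := expWeight_add_div_le s hσ hε hη hη'
          rw [add_sub_cancel] at h
          calc _ ≤ _ := mul_le_mul_left h _
            _ = _ := by ring
      _ = _ := by rw [lintegral_const_mul' _ _ ENNReal.ofReal_ne_top, mul_assoc]
  have hconv : ∫⁻ ξ, ∫⁻ η, Φ q η * Φ p (ξ - η) = (∫⁻ η, Φ q η) * ∫⁻ η, Φ p η := by
    rw [lintegral_lintegral_swap (by
      exact (by fun_prop : Measurable fun z : ℝ × ℝ => Φ q z.2 * Φ p (z.1 - z.2)).aemeasurable),
      ← lintegral_mul_const _ hΦq]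
    congr 1 with η
    rw [lintegral_const_mul _ (by fun_prop), lintegral_sub_right_eq_self (Φ p)]
  have hprod : (∫⁻ η, Φ q η) * ∫⁻ η, Φ p η ≤
      (∫⁻ η, tailWeight ε₀ (min σ 1) η ^ 2) * (wnormTwo s σ p * wnormTwo s σ q) := by
    refine (ENNReal.pow_le_pow_left_iff two_ne_zero).1 ?_
    rw [mul_pow]
    refine (mul_le_mul' (lintegral_tailWeight_mul_le s σ ε₀ (min σ 1) hq.integrable)
      (lintegral_tailWeight_mul_le s σ ε₀ (min σ 1) hp.integrable)).trans_eq ?_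
    ring
  calc wnormOne s σ (gaugeSymbol p q) ≤ ∫⁻ ξ, κ * c * ∫⁻ η, Φ q η * Φ p (ξ - η) :=
        lintegral_mono hpt
    _ = κ * c * ((∫⁻ η, Φ q η) * ∫⁻ η, Φ p η) := by
        rw [lintegral_const_mul' _ _ (ENNReal.mul_ne_top ENNReal.ofReal_ne_top
          ENNReal.ofReal_ne_top), hconv]
    _ ≤ _ := by
        rw [mul_assoc (κ * c)]
        gcongr

theorem wnormOne_const_mul (s σ : ℝ) (a : ℂ) (G : ℝ → ℂ) :
    wnormOne s σ (fun ξ => a * G ξ) = ‖a‖ₑ * wnormOne s σ G := by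
  rw [wnormOne, wnormOne, ← lintegral_const_mul' _ _ enorm_ne_top]
  congr 1 with ξ
  rw [enorm_mul]
  ring

theorem wnormOne_add_le (s σ : ℝ) {F G : ℝ → ℂ} (hF : Integrable F) :
    wnormOne s σ (fun ξ => F ξ + G ξ) ≤ wnormOne s σ F + wnormOne s σ G := by
  simp only [wnormOne]
  have hm : AEMeasurable fun ξ => ENNReal.ofReal (2 ^ (σ / 2)) * expWeight s σ ξ * ‖F ξ‖ₑ :=
    ((measurable_expWeight s σ).const_mul _).aemeasurable.mul hF.aestronglyMeasurable.enorm
  rw [← lintegral_add_left' hm]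
  refine lintegral_mono fun ξ => ?_
  rw [← mul_add]
  exact mul_le_mul_right (enorm_add_le _ _) _

/-- The bilinear estimate for `gaugeSymbol`, with a constant uniform in `s`. -/
theorem exists_wnormOne_gaugeSymbol_le {σ ε₀ : ℝ} (δ : ℝ) (hσ : 0 < σ) (hε : 0 < ε₀) :
    ∃ K : ℝ, 0 ≤ K ∧ ∀ (s : ℝ) {p q : ℝ → ℂ}, FreqGE ε₀ p → FreqGE ε₀ q →
      ‖-(δ : ℂ)‖ₑ * wnormOne s σ (gaugeSymbol p q) ≤
        ENNReal.ofReal K * (wnormTwo s σ p * wnormTwo s σ q) := by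
  set κ : ℝ≥0∞ := ‖-(δ : ℂ)‖ₑ * (ENNReal.ofReal (2 ^ (σ / 2)) * ENNReal.ofReal (2 ^ σ) *
    ∫⁻ η, tailWeight ε₀ (min σ 1) η ^ 2)
  have hκ : κ ≠ ∞ := ENNReal.mul_ne_top enorm_ne_top
    (ENNReal.mul_ne_top (ENNReal.mul_ne_top ENNReal.ofReal_ne_top ENNReal.ofReal_ne_top)
      (lintegral_tailWeight_sq_lt_top hε (lt_min hσ one_pos)).ne)
  refine ⟨κ.toReal, ENNReal.toReal_nonneg, fun s p q hp hq => ?_⟩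
  rw [ENNReal.ofReal_toReal hκ]
  refine (mul_le_mul_right (wnormOne_gaugeSymbol_le s hσ hε hp hq) _).trans_eq ?_
  rw [← mul_assoc]

theorem wnormTwo_gaugeT_sub_le {σ ε₀ δ K : ℝ} (s : ℝ) (hσ : 0 < σ) (hε : 0 < ε₀) (hK0 : 0 ≤ K)
    (hK : ∀ {p q : ℝ → ℂ}, FreqGE ε₀ p → FreqGE ε₀ q →
      ‖-(δ : ℂ)‖ₑ * wnormOne s σ (gaugeSymbol p q) ≤
        ENNReal.ofReal K * (wnormTwo s σ p * wnormTwo s σ q))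
    {p q : ℝ → ℂ} (hp : FreqGE ε₀ p) (hq : FreqGE ε₀ q) {m : ℝ} (hm : 0 ≤ m)
    (hpm : wnormTwo s σ p ≤ ENNReal.ofReal m) (hqm : wnormTwo s σ q ≤ ENNReal.ofReal m) :
    wnormTwo s σ (fun x => gaugeT δ p x - gaugeT δ q x) ≤
      ENNReal.ofReal (Real.exp (K * m ^ 2) * (1 + 2 * (K * m ^ 2))) *
        wnormTwo s σ (fun x => p x - q x) := by
  have hpq := hp.sub hq
  set D := wnormTwo s σ (fun x => p x - q x)
  set k := ENNReal.ofReal K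
  set μ := ENNReal.ofReal m
  have hr : ENNReal.ofReal (K * m ^ 2) = k * (μ * μ) := by
    rw [ENNReal.ofReal_mul hK0, pow_two, ENNReal.ofReal_mul hm]
  have hself : ∀ {w : ℝ → ℂ}, FreqGE ε₀ w → wnormTwo s σ w ≤ μ →
      wnormOne s σ (fun ξ => -(δ : ℂ) * gaugeSymbol w w ξ) ≤ ENNReal.ofReal (K * m ^ 2) := by
    intro w hw hwm
    rw [wnormOne_const_mul, hr]
    exact (hK hw hw).trans (by gcongr)
  have hdiff : wnormOne s σ (fun ξ => -(δ : ℂ) * gaugeSymbol p p ξ -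
      -(δ : ℂ) * gaugeSymbol q q ξ) ≤ 2 * (k * (μ * D)) := by
    simp_rw [← mul_sub, gaugeSymbol_sub hp hq]
    rw [wnormOne_const_mul]
    calc _ ≤ ‖-(δ : ℂ)‖ₑ * (wnormOne s σ (gaugeSymbol (fun x => p x - q x) p) +
          wnormOne s σ (gaugeSymbol q (fun x => p x - q x))) :=
          mul_le_mul_right (wnormOne_add_le s σ (integrable_gaugeSymbol hε hpq hp)) _
      _ ≤ k * (D * μ) + k * (μ * D) := by
          rw [mul_add]
          exact add_le_add ((hK hpq hp).trans (by gcongr)) ((hK hq hpq).trans (by gcongr))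
      _ = _ := by ring
  simp_rw [gaugeT_eq hε δ hp, gaugeT_eq hε δ hq]
  refine (wnormTwo_mul_exp_sub_le s hσ.le (by positivity : 0 ≤ K * m ^ 2) hp.integrable
    hq.integrable ((integrable_gaugeSymbol hε hp hp).const_mul _)
    ((integrable_gaugeSymbol hε hq hq).const_mul _) (hself hp hpm) (hself hq hqm)).trans ?_
  rw [ENNReal.ofReal_mul (by positivity), ENNReal.ofReal_add (by norm_num) (by positivity),
    ENNReal.ofReal_mul (by norm_num), hr, mul_assoc]
  refine mul_le_mul_right ?_ _
  calc _ ≤ D + μ * (2 * (k * (μ * D))) := by gcongr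
    _ = _ := by
        rw [ENNReal.ofReal_one, ENNReal.ofReal_ofNat]
        ring

theorem SchwartzMap.freqGE {ε₀ : ℝ} (u : SchwartzMap ℝ ℂ)
    (hu : Function.support (𝓕 ⇑u) ⊆ Set.Ici ε₀) : FreqGE ε₀ u where
  continuous := u.continuous
  integrable := u.integrable
  integrable_fourier := (𝓕 u).integrable
  fourier_eq_zero ξ hξ := by
    by_contra h
    exact (hu h).not_gt hξ

theorem expWeight_mul_enorm_sq (s σ ξ : ℝ) (z : ℂ) :
    (expWeight s σ ξ * ‖z‖ₑ) ^ 2 =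
      ENNReal.ofReal ((1 + ξ ^ 2) ^ σ * (2 : ℝ) ^ (2 * s * ξ) * ‖z‖ ^ 2) := by
  rw [expWeight, ← ofReal_norm, ← ENNReal.ofReal_mul (by positivity),
    ← ENNReal.ofReal_pow (by positivity), mul_pow, mul_pow,
    ← Real.rpow_mul_natCast (by positivity), ← Real.rpow_mul_natCast (by positivity)]
  congr 4 <;> (push_cast; ring)

theorem ofReal_Enorm_sq (s σ : ℝ) (f : ℝ → ℂ) :
    ENNReal.ofReal (Enorm s σ f) ^ 2 = ENNReal.ofReal
      (∫ ξ : ℝ, (1 + ξ ^ 2) ^ σ * (2 : ℝ) ^ (2 * s * |ξ|) * ‖𝓕 f ξ‖ ^ 2) := by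
  rw [Enorm, ← Real.sqrt_eq_rpow, ← ENNReal.ofReal_pow (Real.sqrt_nonneg _),
    Real.sq_sqrt (integral_nonneg fun ξ => by positivity)]

theorem ofReal_Enorm_le {s : ℝ} (σ : ℝ) (hs : s ≤ 0) (f : ℝ → ℂ) :
    ENNReal.ofReal (Enorm s σ f) ≤ wnormTwo s σ f := by
  refine (ENNReal.pow_le_pow_left_iff two_ne_zero).1 ?_
  rw [ofReal_Enorm_sq, wnormTwo, eLpNorm_two_sq, ← Real.enorm_of_nonneg
    (integral_nonneg fun ξ => by positivity)]
  refine (enorm_integral_le_lintegral_enorm _).trans (lintegral_mono fun ξ => ?_)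
  rw [expWeight_mul_enorm_sq, Real.enorm_of_nonneg (by positivity)]
  have h : 2 * s * |ξ| ≤ 2 * s * ξ := mul_le_mul_of_nonpos_left (le_abs_self ξ) (by linarith)
  gcongr
  norm_num

theorem integrable_rpow_mul_norm_sq {σ : ℝ} (u : SchwartzMap ℝ ℂ) :
    Integrable fun ξ : ℝ => (1 + ξ ^ 2) ^ σ * ‖u ξ‖ ^ 2 := by
  obtain ⟨n, hn⟩ := exists_nat_ge σ
  obtain ⟨M, hM⟩ := u.decay 0 0
  have hu : ∀ ξ, ‖u ξ‖ ≤ M := fun ξ => by simpa using hM.2 ξ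
  have h0 := u.integrable_pow_mul volume 0
  have h2 := u.integrable_pow_mul volume (2 * n)
  refine ((h0.add h2).const_mul (2 ^ (n - 1) * M)).mono' ?_ (.of_forall fun ξ => ?_)
  · have hc : Continuous fun ξ : ℝ => (1 + ξ ^ 2) ^ σ * ‖u ξ‖ ^ 2 :=
      ((by fun_prop : Continuous fun ξ : ℝ => 1 + ξ ^ 2).rpow_const
        fun ξ => Or.inl (by positivity)).mul (u.continuous.norm.pow 2)
    exact hc.aestronglyMeasurable
  · rw [Real.norm_of_nonneg (by positivity)]
    have h1 : (1 + ξ ^ 2) ^ σ ≤ 2 ^ (n - 1) * (1 + (ξ ^ 2) ^ n) := by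
      calc (1 + ξ ^ 2) ^ σ ≤ (1 + ξ ^ 2) ^ (n : ℝ) :=
            Real.rpow_le_rpow_of_exponent_le (by nlinarith) hn
        _ = (1 + ξ ^ 2) ^ n := Real.rpow_natCast _ _
        _ ≤ _ := by simpa using add_pow_le zero_le_one (sq_nonneg ξ) n
    calc (1 + ξ ^ 2) ^ σ * ‖u ξ‖ ^ 2
        ≤ (2 ^ (n - 1) * (1 + (ξ ^ 2) ^ n)) * (M * ‖u ξ‖) := by
          rw [pow_two ‖u ξ‖]
          gcongr
          exact hu ξ
      _ = _ := by
          simp only [Pi.add_apply, pow_zero, Real.norm_eq_abs, pow_mul, sq_abs]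
          ring

theorem SchwartzMap.ofReal_Enorm {s σ ε₀ : ℝ} (hs : s ≤ 0) (hε : 0 < ε₀) (u : SchwartzMap ℝ ℂ)
    (hu : FreqGE ε₀ u) : ENNReal.ofReal (Enorm s σ u) = wnormTwo s σ u := by
  refine (ENNReal.pow_right_strictMono two_ne_zero).injective ?_
  have hint : Integrable fun ξ : ℝ =>
      (1 + ξ ^ 2) ^ σ * (2 : ℝ) ^ (2 * s * |ξ|) * ‖𝓕 ⇑u ξ‖ ^ 2 := by
    refine (integrable_rpow_mul_norm_sq (σ := σ) (𝓕 u)).mono' ?_ (.of_forall fun ξ => ?_)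
    · have h := (continuous_fourier hu.integrable).measurable
      exact (by fun_prop : Measurable _).aestronglyMeasurable
    · rw [Real.norm_of_nonneg (by positivity)]
      have h : (2 : ℝ) ^ (2 * s * |ξ|) ≤ 1 := Real.rpow_le_one_of_one_le_of_nonpos (by norm_num)
        (mul_nonpos_of_nonpos_of_nonneg (by linarith) (abs_nonneg ξ))
      rw [mul_right_comm]
      exact mul_le_of_le_one_right (by positivity) h
  change ENNReal.ofReal _ ^ 2 = wnormTwo s σ u ^ 2
  rw [ofReal_Enorm_sq, wnormTwo, eLpNorm_two_sq,
    ofReal_integral_eq_lintegral_ofReal hint (.of_forall fun ξ => by positivity)]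
  congr 1 with ξ
  rw [expWeight_mul_enorm_sq]
  rcases lt_or_ge ξ ε₀ with h | h
  · simp [hu.fourier_eq_zero ξ h]
  · rw [abs_of_nonneg (hε.le.trans h)]

theorem Enorm_nonneg (s σ : ℝ) (f : ℝ → ℂ) : 0 ≤ Enorm s σ f :=
  Real.rpow_nonneg (integral_nonneg fun ξ => by positivity) _

/-- Lipschitz-type bound for the gauge transform in `E^s_σ`: for `σ > 0`, `ε₀ > 0`, `δ ∈ ℝ`,
there is `C > 0` such that for all `s ≤ 0` and Schwartz `u, v` with Fourier support in
`[ε₀, ∞)`: `‖𝒢(u) − 𝒢(v)‖_{E^s_σ} ≤ (exp(C‖u‖²) + exp(C‖v‖²)) ‖u − v‖_{E^s_σ}`. -/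
theorem stmt_12 (σ ε₀ δ : ℝ) (hσ : 0 < σ) (hε : 0 < ε₀) :
    ∃ C > 0, ∀ s ≤ (0 : ℝ), ∀ u v : SchwartzMap ℝ ℂ,
      Function.support (𝓕 ⇑u) ⊆ Set.Ici ε₀ →
      Function.support (𝓕 ⇑v) ⊆ Set.Ici ε₀ →
      Enorm s σ (fun x => gaugeT δ ⇑u x - gaugeT δ ⇑v x)
        ≤ (Real.exp (C * Enorm s σ ⇑u ^ 2) + Real.exp (C * Enorm s σ ⇑v ^ 2))
            * Enorm s σ (fun x => u x - v x) := by
  obtain ⟨K, hK0, hK⟩ := exists_wnormOne_gaugeSymbol_le δ hσ hε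
  refine ⟨3 * K + 1, by positivity, fun s hs u v hu hv => ?_⟩
  have hu' := u.freqGE hu
  have hv' := v.freqGE hv
  set U := Enorm s σ u
  set V := Enorm s σ v
  set D := Enorm s σ (fun x => u x - v x)
  set m := max U V with hm
  have hm0 : 0 ≤ m := (Enorm_nonneg s σ u).trans (le_max_left _ _)
  have hD0 : 0 ≤ D := Enorm_nonneg _ _ _
  have hD : wnormTwo s σ (fun x => u x - v x) = ENNReal.ofReal D :=
    ((u - v).ofReal_Enorm hs hε (hu'.sub hv')).symm
  have key := wnormTwo_gaugeT_sub_le s hσ hε hK0 (hK s) hu' hv' hm0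
    (by rw [← u.ofReal_Enorm hs hε hu']; exact ENNReal.ofReal_le_ofReal (le_max_left _ _))
    (by rw [← v.ofReal_Enorm hs hε hv']; exact ENNReal.ofReal_le_ofReal (le_max_right _ _))
  rw [hD, ← ENNReal.ofReal_mul (by positivity)] at key
  have hreal := (ENNReal.ofReal_le_ofReal_iff (by positivity)).1 ((ofReal_Enorm_le σ hs _).trans key)
  refine hreal.trans (mul_le_mul_of_nonneg_right ?_ hD0)
  calc Real.exp (K * m ^ 2) * (1 + 2 * (K * m ^ 2))
      ≤ Real.exp (K * m ^ 2) * Real.exp (2 * (K * m ^ 2)) := by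
        gcongr
        rw [add_comm]
        exact Real.add_one_le_exp _
    _ = Real.exp (3 * K * m ^ 2) := by rw [← Real.exp_add]; congr 1; ring
    _ ≤ Real.exp ((3 * K + 1) * m ^ 2) := by gcongr; linarith
    _ ≤ _ := by
        rcases max_choice U V with h | h <;> rw [hm, h]
        · exact le_add_of_nonneg_right (Real.exp_pos _).le
        · exact le_add_of_nonneg_left (Real.exp_pos _).le
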